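/- Let t ≥ 1 and let f ∈ ∑_{1≤i,j≤t} A(i) ⊗ A(j) ⊆ A ⊗_K A. For each natural number n > t there exists a K-subspace F' ⊆ (∑_{i : n/(2t) ≤ i ≤ 2tn} A(i)) ⊗ A(n) with dim_K F' ≤ 2^{2t+1}·t·n such that, for every integer m ≥ n, f^m belongs to the right ideal of A ⊗_K A generated by the set of all products h·g·f^{m−n} with h ∈ F' and g ∈ K·1 ⊗ (∑_{i=0}^{t} A(i)). -/

import Mathlib

open TensorProduct

noncomputable section

/-- The free associative unital `K`-algebra on two generators `x, y`. -/
abbrev FA (K : Type) [Field K] : Type := FreeAlgebra K (Fin 2)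

/-- `gp K n` is `A(n)`, the span of the words of length `n` in the two generators. -/
def gp (K : Type) [Field K] (n : ℕ) : Submodule K (FA K) :=
  Submodule.span K {a : FA K | ∃ w : List (Fin 2), w.length = n ∧ a = (w.map (FreeAlgebra.ι K)).prod}

/-- The canonical image of `U ⊗[K] V` inside `A ⊗[K] A`. -/
def tp (K : Type) [Field K] (U V : Submodule K (FA K)) : Submodule K (FA K ⊗[K] FA K) :=
  Submodule.map₂ (TensorProduct.mk K (FA K) (FA K)) U V

/-- `∑_{i=lo}^{hi} A(i)`. -/
def sumGp (K : Type) [Field K] (lo hi : ℕ) : Submodule K (FA K) :=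
  ⨆ i ∈ Finset.Icc lo hi, gp K i

/-- `∑_{i : n/(2t) ≤ i ≤ 2tn} A(i)` (the condition `n/(2t) ≤ i` is encoded as `n ≤ 2ti`). -/
def midGp (K : Type) [Field K] (t n : ℕ) : Submodule K (FA K) :=
  ⨆ i ∈ {i : ℕ | n ≤ 2 * t * i ∧ i ≤ 2 * t * n}, gp K i

/-- The right ideal of `A ⊗[K] A` generated by a set `X`: the span of `X·(A ⊗ A)`. -/
def rIdeal (K : Type) [Field K] (X : Set (FA K ⊗[K] FA K)) :
    Submodule K (FA K ⊗[K] FA K) :=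
  Submodule.span K X * ⊤

theorem word_mem_gp (K : Type) [Field K] (w : List (Fin 2)) :
    (w.map (FreeAlgebra.ι K)).prod ∈ gp K w.length :=
  Submodule.subset_span ⟨w, rfl, rfl⟩

theorem one_mem_gp_zero (K : Type) [Field K] : (1 : FA K) ∈ gp K 0 := by
  simpa using word_mem_gp K []

theorem gp_le_sumGp (K : Type) [Field K] {lo hi i : ℕ} (h₁ : lo ≤ i) (h₂ : i ≤ hi) :
    gp K i ≤ sumGp K lo hi :=
  le_iSup₂_of_le i (Finset.mem_Icc.2 ⟨h₁, h₂⟩) le_rfl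

theorem gp_mul_gp_le (K : Type) [Field K] (i j : ℕ) : gp K i * gp K j ≤ gp K (i + j) := by
  unfold gp
  rw [Submodule.span_mul_span, Submodule.span_le]
  rintro _ ⟨_, ⟨v, rfl, rfl⟩, _, ⟨w, rfl, rfl⟩, rfl⟩
  exact Submodule.subset_span ⟨v ++ w, by simp, by simp⟩

theorem sumGp_mul_sumGp_le (K : Type) [Field K] (a b c d : ℕ) :
    sumGp K a b * sumGp K c d ≤ sumGp K (a + c) (b + d) := by
  conv_lhs => unfold sumGp
  simp only [Submodule.iSup_mul, Submodule.mul_iSup, iSup_le_iff, Finset.mem_Icc]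
  intro j hj i hi
  exact (gp_mul_gp_le K i j).trans (gp_le_sumGp K (by omega) (by omega))

theorem tp_mono (K : Type) [Field K] {U U' V V' : Submodule K (FA K)} (hU : U ≤ U')
    (hV : V ≤ V') : tp K U V ≤ tp K U' V' :=
  Submodule.map₂_le_map₂ hU hV

theorem tmul_mem_tp (K : Type) [Field K] {U V : Submodule K (FA K)} {u v : FA K} (hu : u ∈ U)
    (hv : v ∈ V) : u ⊗ₜ[K] v ∈ tp K U V :=
  Submodule.apply_mem_map₂ _ hu hv

theorem tp_mul_tp_le (K : Type) [Field K] (U V U' V' : Submodule K (FA K)) :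
    tp K U V * tp K U' V' ≤ tp K (U * U') (V * V') := by
  unfold tp
  rw [Submodule.map₂_eq_span_image2, Submodule.map₂_eq_span_image2 _ U' V',
    Submodule.span_mul_span, Submodule.span_le]
  rintro _ ⟨_, ⟨u, hu, v, hv, rfl⟩, _, ⟨u', hu', v', hv', rfl⟩, rfl⟩
  simp only [TensorProduct.mk_apply, Algebra.TensorProduct.tmul_mul_tmul]
  exact tmul_mem_tp K (Submodule.mul_mem_mul hu hu') (Submodule.mul_mem_mul hv hv')

/-- Splitting off the components of degree at least `n`. -/
theorem sumGp_le_sup (K : Type) [Field K] (a b c n : ℕ) (hb : b ≤ c) :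
    sumGp K a b ≤ sumGp K a (min (n - 1) b) ⊔ sumGp K n c := by
  refine iSup₂_le fun i hi => ?_
  rw [Finset.mem_Icc] at hi
  by_cases h : n ≤ i
  · exact le_sup_of_le_right (gp_le_sumGp K h (by omega))
  · exact le_sup_of_le_left (gp_le_sumGp K hi.1 (by omega))

theorem sumGp_eq_bot (K : Type) [Field K] {a b : ℕ} (h : b < a) : sumGp K a b = ⊥ := by
  simp [sumGp, Finset.Icc_eq_empty (not_le.2 h)]

/-- Multiplying a component of `f ^ k` of low second degree by `f` and splitting the result. -/
theorem exists_mul_eq_add (K : Type) [Field K] (t n : ℕ) (hn : t < n) (f : FA K ⊗[K] FA K)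
    (hf : f ∈ tp K (sumGp K 1 t) (sumGp K 1 t)) (k : ℕ) (hk : k < n) (x : FA K ⊗[K] FA K)
    (hx : x ∈ tp K (sumGp K k (t * k)) (sumGp K k (min (n - 1) (t * k)))) :
    ∃ y g, y ∈ tp K (sumGp K (k + 1) (t * (k + 1)))
        (sumGp K (k + 1) (min (n - 1) (t * (k + 1)))) ∧
      g ∈ tp K (midGp K t n) (sumGp K n (n - 1 + t)) ∧ x * f = y + g := by
  have hxf : x * f ∈ tp K (sumGp K (k + 1) (t * (k + 1)))
      (sumGp K (k + 1) (min (n - 1) (t * k) + t)) :=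
    tp_mono K (sumGp_mul_sumGp_le K _ _ _ _) (sumGp_mul_sumGp_le K _ _ _ _)
      (tp_mul_tp_le K _ _ _ _ (Submodule.mul_mem_mul hx hf))
  have hmul : t * (k + 1) = t * k + t := by ring
  by_cases hc : t * (k + 1) < n
  · refine ⟨x * f, 0, ?_, zero_mem _, by simp⟩
    convert hxf using 3
    omega
  · have hle := tp_mono K le_rfl (sumGp_le_sup K (k + 1) (min (n - 1) (t * k) + t)
      (n - 1 + t) n (by omega)) hxf
    unfold tp at hle
    rw [Submodule.map₂_sup_right] at hle
    obtain ⟨y, hy, g, hg, hyg⟩ := Submodule.mem_sup.1 hle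
    refine ⟨y, g, ?_, tp_mono K ?_ le_rfl hg, hyg.symm⟩
    · rwa [show min (n - 1) (min (n - 1) (t * k) + t) = min (n - 1) (t * (k + 1)) by omega] at hy
    · refine iSup₂_le fun i hi => ?_
      rw [Finset.mem_Icc] at hi
      refine le_iSup₂_of_le (f := fun i _ => gp K i) i ⟨?_, ?_⟩ le_rfl
      · have := Nat.mul_le_mul_left t hi.1
        rw [mul_assoc]
        omega
      · have := Nat.mul_le_mul_left t (show k + 1 ≤ n from hk)
        rw [mul_assoc]
        omega

/-- Every power `f ^ m` with `n ≤ m` is a combination of lower powers of `f` with coefficients of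
second degree between `n` and `n - 1 + t`. -/
theorem exists_pow_eq_sum (K : Type) [Field K] (t n : ℕ) (hn : t < n) (f : FA K ⊗[K] FA K)
    (hf : f ∈ tp K (sumGp K 1 t) (sumGp K 1 t)) :
    ∃ G : Fin n → FA K ⊗[K] FA K,
      (∀ k, G k ∈ tp K (midGp K t n) (sumGp K n (n - 1 + t))) ∧
      f ^ n = ∑ k, G k * f ^ (n - 1 - k) := by
  have key : ∀ k ≤ n, ∃ G : Fin k → FA K ⊗[K] FA K,
      (∀ i, G i ∈ tp K (midGp K t n) (sumGp K n (n - 1 + t))) ∧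
      ∃ x ∈ tp K (sumGp K k (t * k)) (sumGp K k (min (n - 1) (t * k))),
        f ^ k = x + ∑ i, G i * f ^ (k - 1 - i) := by
    intro k
    induction k with
    | zero =>
      intro _
      refine ⟨Fin.elim0, fun i => i.elim0, 1, ?_, by simp⟩
      have h := gp_le_sumGp K (le_refl 0) (le_refl 0) (one_mem_gp_zero K)
      simpa [Algebra.TensorProduct.one_def] using tmul_mem_tp K h h
    | succ k ih =>
      intro hk
      obtain ⟨G, hG, x, hx, e⟩ := ih (by omega)
      obtain ⟨y, g, hy, hg, e'⟩ := exists_mul_eq_add K t n hn f hf k hk x hx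
      refine ⟨Fin.snoc G g, fun i => ?_, y, hy, ?_⟩
      · refine Fin.lastCases ?_ (fun i => ?_) i
        · simpa using hg
        · simpa using hG i
      · rw [Fin.sum_univ_castSucc, pow_succ, e, add_mul, e', Finset.sum_mul]
        have hs : ∀ i : Fin k, G i * f ^ (k - 1 - (i : ℕ)) * f = G i * f ^ (k - (i : ℕ)) := by
          intro i
          rw [mul_assoc, ← pow_succ]
          congr 2
          omega
        simp only [hs, Fin.snoc_castSucc, Fin.snoc_last, Fin.val_castSucc, Fin.val_last,
          Nat.add_sub_cancel, Nat.sub_self, pow_zero, mul_one]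
        abel
  obtain ⟨G, hG, x, hx, e⟩ := key n le_rfl
  refine ⟨G, hG, ?_⟩
  rw [sumGp_eq_bot K (show min (n - 1) (t * n) < n by omega), tp, Submodule.map₂_bot_right,
    Submodule.mem_bot] at hx
  rw [e, hx, zero_add]

/-- Elements of second degree between `n` and `n - 1 + t` are combinations of the `1 ⊗ v`, with `v`
a word of length less than `t`, with left coefficients of second degree `n`. -/
theorem exists_eq_sum_mul_word (K : Type) [Field K] (t n : ℕ) (M : Submodule K (FA K))
    (z : FA K ⊗[K] FA K) (hz : z ∈ tp K M (sumGp K n (n - 1 + t))) (hn : 0 < n) :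
    ∃ H : (Σ i : Fin t, Fin i → Fin 2) → FA K ⊗[K] FA K, (∀ v, H v ∈ tp K M (gp K n)) ∧
      z = ∑ v, H v * (1 ⊗ₜ[K] ((List.ofFn v.2).map (FreeAlgebra.ι K)).prod) := by
  let P : Submodule K (FA K ⊗[K] FA K) := ⨆ v : Σ i : Fin t, Fin i → Fin 2,
    (tp K M (gp K n)).map (LinearMap.mulRight K
      (1 ⊗ₜ[K] ((List.ofFn v.2).map (FreeAlgebra.ι K)).prod))
  have hP : tp K M (sumGp K n (n - 1 + t)) ≤ P := by
    refine Submodule.map₂_le.2 fun a ha b hb => ?_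
    suffices h : sumGp K n (n - 1 + t) ≤ P.comap (TensorProduct.mk K (FA K) (FA K) a) from h hb
    refine iSup₂_le fun i hi => Submodule.span_le.2 ?_
    rw [Finset.mem_Icc] at hi
    rintro _ ⟨w, rfl, rfl⟩
    have hlen : (w.drop n).length < t := by
      rw [List.length_drop]
      omega
    refine Submodule.mem_iSup_of_mem ⟨⟨(w.drop n).length, hlen⟩, (w.drop n).get⟩ ?_
    refine Submodule.mem_map.2 ⟨a ⊗ₜ[K] ((w.take n).map (FreeAlgebra.ι K)).prod,
      tmul_mem_tp K ha ?_, ?_⟩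
    · have := word_mem_gp K (w.take n)
      rwa [List.length_take_of_le hi.1] at this
    · rw [LinearMap.mulRight_apply, Algebra.TensorProduct.tmul_mul_tmul, mul_one, List.ofFn_get,
        ← List.prod_append, ← List.map_append, List.take_append_drop]
      rfl
  obtain ⟨c, hc, hsum⟩ := (Submodule.mem_iSup_iff_exists_finsupp _ _).1 (hP hz)
  choose H hH e using fun v => Submodule.mem_map.1 (hc v)
  refine ⟨H, hH, ?_⟩
  rw [← hsum, Finsupp.sum_fintype _ _ (fun _ => rfl)]
  exact Finset.sum_congr rfl fun v _ => (e v).symm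

theorem card_words_le (t : ℕ) :
    Fintype.card (Σ i : Fin t, Fin i → Fin 2) ≤ t * 2 ^ t := by
  rw [Fintype.card_sigma]
  refine (Finset.sum_le_card_nsmul _ _ (2 ^ t) fun i _ => ?_).trans (by simp)
  simpa using Nat.pow_le_pow_right two_pos i.2.le

theorem statement11 (K : Type) [Field K] (t : ℕ) (ht : 1 ≤ t)
    (f : FA K ⊗[K] FA K)
    (hf : f ∈ ⨆ i ∈ Finset.Icc 1 t, ⨆ j ∈ Finset.Icc 1 t, tp K (gp K i) (gp K j))
    (n : ℕ) (hn : t < n) :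
    ∃ F : Submodule K (FA K ⊗[K] FA K),
      F ≤ tp K (midGp K t n) (gp K n) ∧
      FiniteDimensional K F ∧
      Module.finrank K F ≤ 2 ^ (2 * t + 1) * t * n ∧
      ∀ m : ℕ, n ≤ m →
        f ^ m ∈ rIdeal K
          {z | ∃ h ∈ F, ∃ g ∈ tp K (gp K 0) (sumGp K 0 t), z = h * g * f ^ (m - n)} := by
  have hf' : f ∈ tp K (sumGp K 1 t) (sumGp K 1 t) := by
    refine (iSup₂_le fun i hi => iSup₂_le fun j hj => ?_ :
      _ ≤ tp K (sumGp K 1 t) (sumGp K 1 t)) hf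
    rw [Finset.mem_Icc] at hi hj
    exact tp_mono K (gp_le_sumGp K hi.1 hi.2) (gp_le_sumGp K hj.1 hj.2)
  obtain ⟨G, hG, hpow⟩ := exists_pow_eq_sum K t n hn f hf'
  choose H hH e using fun k => exists_eq_sum_mul_word K t n _ (G k) (hG k) (by omega)
  let φ : Fin n × (Σ i : Fin t, Fin i → Fin 2) → FA K ⊗[K] FA K := fun p => H p.1 p.2
  refine ⟨Submodule.span K (Set.range φ), ?_, FiniteDimensional.span_of_finite K
    (Set.finite_range φ), ?_, fun m hm => ?_⟩
  · rw [Submodule.span_le]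
    rintro _ ⟨p, rfl⟩
    exact hH p.1 p.2
  · refine (finrank_range_le_card φ).trans ?_
    rw [Fintype.card_prod, Fintype.card_fin]
    calc n * Fintype.card (Σ i : Fin t, Fin i → Fin 2) ≤ n * (t * 2 ^ t) :=
          Nat.mul_le_mul_left _ (card_words_le t)
      _ = 2 ^ t * t * n := by ring
      _ ≤ 2 ^ (2 * t + 1) * t * n := by
          gcongr
          · norm_num
          · omega
  · rw [← Nat.add_sub_cancel' hm, pow_add, hpow, Nat.add_sub_cancel_left, Finset.sum_mul]
    refine Submodule.sum_mem _ fun k _ => ?_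
    rw [e k, Finset.sum_mul, Finset.sum_mul]
    refine Submodule.sum_mem _ fun v _ => ?_
    rw [mul_assoc, ← pow_add, add_comm, pow_add, ← mul_assoc]
    refine Submodule.mul_mem_mul (Submodule.subset_span
      ⟨H k v, Submodule.subset_span ⟨(k, v), rfl⟩, _, ?_, rfl⟩) Submodule.mem_top
    refine tmul_mem_tp K (one_mem_gp_zero K)
      (gp_le_sumGp K (Nat.zero_le v.1) v.1.2.le ?_)
    simpa only [List.length_ofFn] using word_mem_gp K (List.ofFn v.2)
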